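/- arXiv:1212.3064 — 2 statements merged into one kernel-verified Lean document; each statement's English description precedes it below -/
import Mathlib

section
/- The following are equivalent: (1) φ is periodic; (2) for some n ∈ ℕ, b_φ(n) is finite and b_φ(n+1) = b_φ(n); (3) the subword complexity is bounded: there is C ∈ ℕ with b_φ(n) ≤ C for all n ∈ ℕ. -/
open SimpleGraph

/-- Equivalence of colored `n`-balls around `x` and `y`: a graph isomorphism between the
induced subgraphs on the balls, sending center to center and preserving the coloring. -/
def BallEquiv {V A : Type*} (T : SimpleGraph V) (φ : V → A) (n : ℕ) (x y : V) : Prop :=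
  ∃ f : {v : V // T.dist x v ≤ n} ≃ {v : V // T.dist y v ≤ n},
    ((f ⟨x, by simp [SimpleGraph.dist_self]⟩ : {v : V // T.dist y v ≤ n}) : V) = y ∧
    (∀ u w : {v : V // T.dist x v ≤ n}, T.Adj (u : V) (w : V) ↔ T.Adj (f u : V) (f w : V)) ∧
    ∀ v : {v : V // T.dist x v ≤ n}, φ (f v : V) = φ (v : V)

/-- Two vertices are in the same class if a color-preserving automorphism of `T`
sends one to the other. -/
def SameClass {V A : Type*} (T : SimpleGraph V) (φ : V → A) (x y : V) : Prop :=
  ∃ g : V ≃ V, (∀ u w : V, T.Adj (g u) (g w) ↔ T.Adj u w) ∧ g x = y ∧ ∀ v, φ (g v) = φ v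

/-- Subword complexity: the number of equivalence classes of colored `n`-balls. -/
noncomputable def ballComplexity {V A : Type*} (T : SimpleGraph V) (φ : V → A) (n : ℕ) : ℕ :=
  Nat.card (Quot (BallEquiv T φ n))

/-- A coloring is periodic if it is invariant under a subgroup of the automorphism group
of `T` having finitely many orbits on vertices. -/
def IsPeriodicColoring {V A : Type*} (T : SimpleGraph V) (φ : V → A) : Prop :=
  ∃ Γ : Subgroup (Equiv.Perm V),
    (∀ γ ∈ Γ, ∀ u w : V, T.Adj (γ u) (γ w) ↔ T.Adj u w) ∧
    (∀ γ ∈ Γ, ∀ v, φ (γ v) = φ v) ∧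
    Finite (Quot (fun x y : V => ∃ γ ∈ Γ, γ x = y))

/-- The colored `n`-ball around `x` is special. -/
def IsSpecial {V A : Type*} (T : SimpleGraph V) (φ : V → A) (n : ℕ) (x : V) : Prop :=
  ∃ y z : V, BallEquiv T φ n x y ∧ BallEquiv T φ n x z ∧ ¬ BallEquiv T φ (n + 1) y z

/-- The type set of a vertex. -/
def TypeSet {V A : Type*} (T : SimpleGraph V) (φ : V → A) (x : V) : Set ℕ :=
  {n : ℕ | IsSpecial T φ n x}

/-- The maximal type of a vertex of bounded type (`-1` if the type set is empty). -/
noncomputable def maxType {V A : Type*} (T : SimpleGraph V) (φ : V → A) (x : V) : ℤ :=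
  sSup (insert (-1) ((fun n : ℕ => (n : ℤ)) '' TypeSet T φ x))

/-- The coloring is Sturmian if its subword complexity is `n + 2`. -/
def IsSturmian {V A : Type*} (T : SimpleGraph V) (φ : V → A) : Prop :=
  ∀ n : ℕ, ballComplexity T φ n = n + 2

/-- Eventually periodic coloring. -/
def IsEventuallyPeriodic {V A : Type*} (T : SimpleGraph V) (φ : V → A) : Prop :=
  ∃ K : Set V, K.Nonempty ∧ K.Finite ∧ (T.induce K).Connected ∧
    ∀ v : (Kᶜ : Set V), ∃ ψ : V → A, IsPeriodicColoring T ψ ∧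
      ∀ w : (Kᶜ : Set V), (T.induce (Kᶜ : Set V)).Reachable v w → ψ (w : V) = φ (w : V)

/-- The vertex set of the `n`-branch from `x` towards its neighbor `x'`. -/
def branchSet {V : Type*} (T : SimpleGraph V) (n : ℕ) (x x' : V) : Set V :=
  insert x {y : V | T.dist x y ≤ n ∧ T.dist y x' < T.dist y x}

/-- Equivalence of colored `n`-branches. -/
def BranchEquiv {V A : Type*} (T : SimpleGraph V) (φ : V → A) (n : ℕ)
    (x x' y y' : V) : Prop :=
  ∃ f : (branchSet T n x x') ≃ (branchSet T n y y'),
    ((f ⟨x, Set.mem_insert x _⟩ : (branchSet T n y y')) : V) = y ∧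
    (∀ u w : (branchSet T n x x'), T.Adj (u : V) (w : V) ↔ T.Adj (f u : V) (f w : V)) ∧
    ∀ v : (branchSet T n x x'), φ (f v : V) = φ (v : V)

/-- A coloring of `K` appears exactly once if the only connected subgraph of `T`
color-isomorphic to it is `K` itself. -/
def AppearsOnce {V A : Type*} (T : SimpleGraph V) (φ : V → A) (K : Set V) : Prop :=
  ∀ K' : Set V, (T.induce K').Connected →
    (∃ f : K ≃ K', (∀ u w : K, T.Adj (u : V) (w : V) ↔ T.Adj (f u : V) (f w : V)) ∧
      ∀ v : K, φ (f v : V) = φ (v : V)) → K' = K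

/-! ### Equivalence of colored balls -/

theorem SimpleGraph.Connected.exists_adj_dist_add_one_eq {V : Type*} {T : SimpleGraph V}
    (hT : T.Connected) {r v : V} (h : v ≠ r) : ∃ p, T.Adj v p ∧ T.dist r p + 1 = T.dist r v := by
  obtain ⟨p, hp⟩ := hT.exists_walk_length_eq_dist v r
  cases p with
  | nil => exact absurd rfl h
  | @cons _ u _ hadj q =>
    refine ⟨u, hadj, ?_⟩
    rw [Walk.length_cons] at hp
    have h1 := dist_le q
    have h2 := hT.dist_triangle (u := v) (v := u) (w := r)
    rw [dist_eq_one_iff_adj.2 hadj] at h2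
    rw [dist_comm (u := r) (v := u), dist_comm (u := r) (v := v)]
    omega

/-- A homomorphism between induced subgraphs does not increase distances from a point whose
`n`-ball is contained in the domain, within that ball. -/
theorem dist_map_le_of_ball_subset {V : Type*} {T : SimpleGraph V} (hT : T.Connected)
    {P Q : V → Prop} (f : Subtype P → Subtype Q)
    (hf : ∀ u w : Subtype P, T.Adj (u : V) (w : V) → T.Adj (f u : V) (f w : V))
    (w : Subtype P) (n : ℕ) (hP : ∀ u, T.dist w u ≤ n → P u) :
    ∀ d ≤ n, ∀ u : Subtype P, T.dist w u ≤ d → T.dist (f w : V) (f u) ≤ d := by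
  intro d
  induction d with
  | zero =>
    intro _ u hu
    have : w = u := Subtype.ext (hT.dist_eq_zero_iff.1 (Nat.le_zero.1 hu))
    simp [this]
  | succ d ih =>
    intro hd u hu
    rcases Nat.lt_or_ge d (T.dist w u) with h | h
    · have hne : (u : V) ≠ w := by rintro he; simp [he] at h
      obtain ⟨u', hadj, hd'⟩ := hT.exists_adj_dist_add_one_eq hne
      have hq : T.dist w u' ≤ d := by omega
      have hu' : P u' := hP _ (by omega)
      have h1 := ih (by omega) ⟨u', hu'⟩ hq
      have h2 := hf ⟨u', hu'⟩ u hadj.symm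
      have h3 := hT.dist_triangle (u := (f w : V)) (v := f ⟨u', hu'⟩) (w := f u)
      rw [dist_eq_one_iff_adj.2 h2] at h3
      omega
    · exact (ih (by omega) u h).trans (by omega)

theorem BallEquiv.of_ball_subset {V A : Type*} {T : SimpleGraph V} {φ : V → A}
    (hT : T.Connected) {P Q : V → Prop} (f : Subtype P ≃ Subtype Q)
    (hf : ∀ u w : Subtype P, T.Adj (u : V) (w : V) ↔ T.Adj (f u : V) (f w : V))
    (hφ : ∀ v : Subtype P, φ (f v) = φ v) (w : Subtype P) (n : ℕ)
    (hP : ∀ u, T.dist w u ≤ n → P u) (hQ : ∀ u, T.dist (f w : V) u ≤ n → Q u) :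
    BallEquiv T φ n w (f w) := by
  have h1 := dist_map_le_of_ball_subset hT f (fun u w h => (hf u w).1 h) w n hP n le_rfl
  have h2 := dist_map_le_of_ball_subset hT f.symm
    (fun u w h => (hf _ _).2 (by simpa using h)) (f w) n hQ n le_rfl
  simp only [Equiv.symm_apply_apply] at h2
  refine ⟨⟨fun u => ⟨f ⟨u, hP _ u.2⟩, h1 _ u.2⟩, fun u => ⟨f.symm ⟨u, hQ _ u.2⟩, h2 _ u.2⟩,
    fun u => by simp, fun u => by simp⟩, rfl, fun u v => hf ⟨u, hP _ u.2⟩ ⟨v, hP _ v.2⟩,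
    fun v => hφ ⟨v, hP _ v.2⟩⟩

theorem ballEquiv_equivalence {V A : Type*} (T : SimpleGraph V) (φ : V → A) (n : ℕ) :
    Equivalence (BallEquiv T φ n) where
  refl x := ⟨Equiv.refl _, rfl, fun _ _ => Iff.rfl, fun _ => rfl⟩
  symm := by
    rintro x y ⟨f, hxy, hadj, hφ⟩
    refine ⟨f.symm, ?_, fun u w => by simp [hadj], fun v => by simp [← hφ]⟩
    have : f.symm ⟨y, by simp⟩ = ⟨x, by simp⟩ := by
      rw [Equiv.symm_apply_eq]
      exact Subtype.ext hxy.symm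
    rw [this]
  trans := by
    rintro x y z ⟨f, hxy, hadj, hφ⟩ ⟨g, hyz, hadj', hφ'⟩
    refine ⟨f.trans g, ?_, fun u w => (hadj u w).trans (hadj' _ _),
      fun v => (hφ' _).trans (hφ v)⟩
    have : f ⟨x, by simp⟩ = ⟨y, by simp⟩ := Subtype.ext hxy
    simpa [this] using hyz

theorem BallEquiv.color_eq {V A : Type*} {T : SimpleGraph V} {φ : V → A} {n : ℕ} {x y : V}
    (h : BallEquiv T φ n x y) : φ x = φ y := by
  obtain ⟨f, hxy, -, hφ⟩ := h
  rw [← hxy, hφ]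

theorem BallEquiv.of_succ {V A : Type*} {T : SimpleGraph V} {φ : V → A} (hT : T.Connected)
    {n : ℕ} {x y : V} (h : BallEquiv T φ (n + 1) x y) : BallEquiv T φ n x y := by
  obtain ⟨f, hxy, hadj, hφ⟩ := h
  have := BallEquiv.of_ball_subset hT f hadj hφ ⟨x, by simp⟩ n
    (fun u (hu : T.dist x u ≤ n) => by omega) (fun u hu => by rw [hxy] at hu; omega)
  rwa [hxy] at this

/-- Equivalent `(n + 1)`-balls have centers whose neighbors match up to equivalence of
`n`-balls. -/
theorem BallEquiv.exists_neighborSet_equiv {V A : Type*} {T : SimpleGraph V} {φ : V → A}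
    (hT : T.Connected) {n : ℕ} {x y : V} (h : BallEquiv T φ (n + 1) x y) :
    ∃ σ : T.neighborSet x ≃ T.neighborSet y, ∀ w : T.neighborSet x, BallEquiv T φ n w (σ w) := by
  obtain ⟨f, hxy, hadj, hφ⟩ := h
  have hx {w : V} (hw : T.Adj x w) : T.dist x w ≤ n + 1 := by
    rw [dist_eq_one_iff_adj.2 hw]; omega
  have hy {w : V} (hw : T.Adj y w) : T.dist y w ≤ n + 1 := by
    rw [dist_eq_one_iff_adj.2 hw]; omega
  have hfx {w : V} (hw : T.Adj x w) : T.Adj y (f ⟨w, hx hw⟩) := by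
    have := (hadj ⟨x, by simp⟩ ⟨w, hx hw⟩).1 hw
    rwa [hxy] at this
  have hfy {w : V} (hw : T.Adj y w) : T.Adj x (f.symm ⟨w, hy hw⟩) := by
    refine (hadj ⟨x, by simp⟩ (f.symm ⟨w, hy hw⟩)).2 ?_
    rw [hxy]
    simpa using hw
  refine ⟨⟨fun w => ⟨f ⟨w, hx w.2⟩, hfx w.2⟩, fun w => ⟨f.symm ⟨w, hy w.2⟩, hfy w.2⟩,
    fun w => by simp, fun w => by simp⟩, fun w => ?_⟩
  refine BallEquiv.of_ball_subset hT f hadj hφ ⟨w, hx w.2⟩ n (fun u hu => ?_) (fun u hu => ?_)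
  · have := hT.dist_triangle (u := x) (v := w) (w := u)
    rw [dist_eq_one_iff_adj.2 w.2] at this
    change T.dist w u ≤ n at hu
    omega
  · have := hT.dist_triangle (u := y) (v := f ⟨w, hx w.2⟩) (w := u)
    rw [dist_eq_one_iff_adj.2 (hfx w.2)] at this
    omega

/-! ### Automorphisms of trees from equitable equivalence relations -/

/-- A graph homomorphism from a connected graph to an acyclic graph that is injective on
neighborhoods is injective. -/
theorem SimpleGraph.Hom.injective_of_locally_injective {V W : Type*} {G : SimpleGraph V}
    {H : SimpleGraph W} (hG : G.Connected) (hH : H.IsAcyclic) (g : G →g H)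
    (hg : ∀ v u w, G.Adj v u → G.Adj v w → g u = g w → u = w) : Function.Injective g := by
  have key : ∀ {a b : V} (p : G.Walk a b), p.edges.IsChain (· ≠ ·) →
      (p.map g).edges.IsChain (· ≠ ·) := by
    intro a b p
    induction p with
    | nil => simp
    | cons h q ih =>
      cases q with
      | nil => simp
      | @cons _ c _ h' q' =>
        intro hc
        simp only [Walk.edges_cons, List.isChain_cons_cons, Walk.map_cons] at hc ih ⊢
        refine ⟨fun he => hc.1 ?_, ih hc.2⟩
        rw [Sym2.eq_swap] at he
        have := Sym2.congr_right.1 he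
        rw [hg _ _ _ h.symm h' this, Sym2.eq_swap]
  intro a b hab
  obtain ⟨p, hp⟩ := hG.exists_isPath a b
  have hc : p.edges.IsChain (· ≠ ·) := by
    have := hp.isTrail.edges_nodup
    exact List.Pairwise.isChain this
  have hpath := (hH.isPath_iff_isChain (p.map g)).2 (key p hc)
  have hnil : ∀ {c d : W} (q : H.Walk c d), c = d → q.IsPath → q.length = 0 := by
    rintro c _ q rfl hq
    exact Walk.length_eq_zero_iff.2 (Walk.isPath_iff_nil.1 hq)
  have := hnil _ hab hpath
  rw [Walk.length_map] at this
  exact Walk.eq_of_length_eq_zero this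

theorem SimpleGraph.IsTree.eq_of_adj_of_dist_lt {V : Type*} {T : SimpleGraph V} (hT : T.IsTree)
    {r v a b : V} (ha : T.Adj v a) (hb : T.Adj v b) (hda : T.dist r a < T.dist r v)
    (hdb : T.dist r b < T.dist r v) : a = b := by
  classical
  obtain ⟨p, hp, hpl⟩ := hT.connected.exists_path_of_dist r v
  have key {c : V} (hc : T.Adj v c) (hdc : T.dist r c < T.dist r v) : c = p.penultimate := by
    obtain ⟨q, hq, hql⟩ := hT.connected.exists_path_of_dist r c
    have hv : v ∉ q.support := by
      intro hv
      have := dist_le (q.takeUntil v hv)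
      have := q.length_takeUntil_le_length hv
      omega
    have := (hT.existsUnique_path r v).unique hp (hq.concat hv hc.symm)
    rw [this, Walk.penultimate_concat]
  rw [key ha hda, key hb hdb]

/-- A matching of neighborhoods can be chosen to send a prescribed neighbor to a prescribed
equivalent neighbor. -/
theorem exists_neighborSet_equiv_apply_eq {V : Type*} {T : SimpleGraph V} {E : V → V → Prop}
    (hE : Equivalence E) {v a p b : V}
    (h : ∃ σ : T.neighborSet v ≃ T.neighborSet a, ∀ w : T.neighborSet v, E w (σ w))
    (hp : T.Adj v p) (hb : T.Adj a b) (hpb : E p b) :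
    ∃ σ : T.neighborSet v ≃ T.neighborSet a, (∀ w : T.neighborSet v, E w (σ w)) ∧
      σ ⟨p, hp⟩ = ⟨b, hb⟩ := by
  classical
  obtain ⟨σ, hσ⟩ := h
  refine ⟨σ.trans (Equiv.swap (σ ⟨p, hp⟩) ⟨b, hb⟩), fun w => ?_, by simp⟩
  have hb' : E b (σ ⟨p, hp⟩) := hE.trans (hE.symm hpb) (hσ ⟨p, hp⟩)
  simp only [Equiv.trans_apply, Equiv.swap_apply_def]
  split_ifs with h1 h2
  · obtain rfl := σ.injective h1
    exact hpb
  · have := hσ w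
    rw [h2] at this
    exact hE.trans this hb'
  · exact hσ w

/-- If equivalent vertices of a tree have neighborhoods that match up to equivalence, then
some automorphism of the tree preserving the classes maps a vertex to any given equivalent one. -/
theorem SimpleGraph.IsTree.exists_automorphism {V : Type*} {T : SimpleGraph V} (hT : T.IsTree)
    {E : V → V → Prop} (hE : Equivalence E)
    (hnb : ∀ x y, E x y → ∃ σ : T.neighborSet x ≃ T.neighborSet y,
      ∀ w : T.neighborSet x, E w (σ w))
    {r s : V} (hrs : E r s) :
    ∃ g : Equiv.Perm V, (∀ u w, T.Adj (g u) (g w) ↔ T.Adj u w) ∧ (∀ v, E v (g v)) ∧ g r = s := by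
  classical
  obtain ⟨σ₀, hσ₀⟩ := hnb r s hrs
  have hS : ∀ v a p b : V, ∃ S : V → V, ∀ (_ : E v a) (hp : T.Adj v p) (hb : T.Adj a b),
      E p b → ∃ σ : T.neighborSet v ≃ T.neighborSet a,
        (∀ w : T.neighborSet v, (σ w : V) = S w) ∧ (∀ w : T.neighborSet v, E w (σ w)) ∧
          σ ⟨p, hp⟩ = ⟨b, hb⟩ := by
    intro v a p b
    by_cases h : E v a ∧ T.Adj v p ∧ T.Adj a b ∧ E p b
    · obtain ⟨h1, h2, h3, h4⟩ := h
      obtain ⟨σ, hσ, hσp⟩ := exists_neighborSet_equiv_apply_eq hE (hnb v a h1) h2 h3 h4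
      refine ⟨fun w => if hw : T.Adj v w then σ ⟨w, hw⟩ else w,
        fun _ _ _ _ => ⟨σ, fun w => ?_, hσ, hσp⟩⟩
      have : T.Adj v w := w.2
      simp [this]
    · exact ⟨id, fun h1 h2 h3 h4 => absurd ⟨h1, h2, h3, h4⟩ h⟩
  choose S hS using hS
  have hpar : ∀ v, ∃ p, v ≠ r → T.Adj v p ∧ T.dist r p + 1 = T.dist r v := by
    intro v
    by_cases h : v = r
    · exact ⟨v, fun h' => absurd h h'⟩
    · exact (hT.connected.exists_adj_dist_add_one_eq h).imp fun _ hp _ => hp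
  choose par hpar using hpar
  have par_eq {v w : V} (h : T.Adj v w) (hd : T.dist r w = T.dist r v + 1) : par w = v := by
    have hw : w ≠ r := by rintro rfl; simp at hd
    obtain ⟨h1, h2⟩ := hpar w hw
    exact hT.eq_of_adj_of_dist_lt (r := r) h1 h.symm (by omega) (by omega)
  let F : ℕ → V → V × V := fun n => n.rec (fun _ => (s, s)) fun m G v =>
    let a := G (par v)
    (if m = 0 then (if hv : T.Adj r v then σ₀ ⟨v, hv⟩ else v)
      else S (par v) a.1 (par (par v)) a.2 v, a.1)
  let g : V → V := fun v => (F (T.dist r v) v).1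
  have hgr : g r = s := by simp [g, F]
  have hF2 (v : V) (hv : v ≠ r) : (F (T.dist r v) v).2 = g (par v) := by
    simp only [g, ← (hpar v hv).2]
    rfl
  have hg0 (v : V) (hv : T.Adj r v) : g v = σ₀ ⟨v, hv⟩ := by
    simp only [g, dist_eq_one_iff_adj.2 hv]
    simp [F, hv]
  have hgS (v w : V) (hv : v ≠ r) (hvw : T.Adj v w) (hd : T.dist r w = T.dist r v + 1) :
      g w = S v (g v) (par v) (g (par v)) w := by
    have h0 : T.dist r v ≠ 0 := by rw [← (hpar v hv).2]; omega
    rw [← hF2 v hv]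
    simp only [g, hd]
    change (if T.dist r v = 0 then _ else _) = _
    rw [if_neg h0, par_eq hvw hd]
  have key : ∀ n v, T.dist r v = n → E v (g v) ∧
      ∃ σ : T.neighborSet v ≃ T.neighborSet (g v),
        (∀ w : T.neighborSet v, (σ w : V) = g w) ∧
          ∀ w : T.neighborSet v, E w (σ w) := by
    intro n
    induction n with
    | zero =>
      intro v hv
      obtain rfl := hT.connected.dist_eq_zero_iff.1 hv
      rw [hgr]
      exact ⟨hrs, σ₀, fun w => (hg0 w w.2).symm, hσ₀⟩
    | succ n ih =>
      intro v hn
      have hv : v ≠ r := by rintro rfl; simp at hn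
      obtain ⟨h1, h2⟩ := hpar v hv
      obtain ⟨hEp, τ, hτ, hEτ⟩ := ih (par v) (by omega)
      have hEv : E v (g v) := by
        have := hEτ ⟨v, h1.symm⟩
        rwa [hτ] at this
      have hadj : T.Adj (g v) (g (par v)) := by
        have : T.Adj (g (par v)) (τ ⟨v, h1.symm⟩) := (τ ⟨v, h1.symm⟩).2
        rw [hτ] at this
        exact this.symm
      obtain ⟨σ, hσ, hEσ, hσp⟩ := hS v (g v) (par v) (g (par v)) hEv h1 hadj hEp
      refine ⟨hEv, σ, fun w => ?_, hEσ⟩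
      have hvw : T.Adj v w := w.2
      by_cases hw : (w : V) = par v
      · obtain rfl : w = ⟨par v, h1⟩ := Subtype.ext hw
        rw [hσp]
      · rw [hσ, hgS v w hv hvw]
        have h3 := hT.dist_eq_dist_add_one_of_adj r hvw
        rcases h3 with h3 | h3
        · exact absurd (hT.eq_of_adj_of_dist_lt (r := r) hvw h1 (by omega) (by omega)) hw
        · exact h3
  have hEg (v : V) := (key _ v rfl).1
  have hloc (v : V) : ∃ σ : T.neighborSet v ≃ T.neighborSet (g v),
      ∀ w : T.neighborSet v, (σ w : V) = g w :=
    (key _ v rfl).2.imp fun _ h => h.1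
  have hhom {u w : V} (h : T.Adj u w) : T.Adj (g u) (g w) := by
    obtain ⟨σ, hσ⟩ := hloc u
    rw [← hσ ⟨w, h⟩]
    exact (σ ⟨w, h⟩).2
  have hlift {u z : V} (h : T.Adj (g u) z) : ∃ w, T.Adj u w ∧ g w = z := by
    obtain ⟨σ, hσ⟩ := hloc u
    exact ⟨σ.symm ⟨z, h⟩, (σ.symm ⟨z, h⟩).2, by rw [← hσ]; simp⟩
  have hinj : Function.Injective g := by
    refine Hom.injective_of_locally_injective hT.connected hT.isAcyclic
      (⟨g, hhom⟩ : T →g T) fun v u w hu hw huw => ?_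
    obtain ⟨σ, hσ⟩ := hloc v
    have : σ ⟨u, hu⟩ = σ ⟨w, hw⟩ := Subtype.ext (by rw [hσ, hσ]; exact huw)
    exact congrArg Subtype.val (σ.injective this)
  have hsurj : Function.Surjective g := by
    have : ∀ {a b : V}, T.Walk a b → (∃ u, g u = a) → ∃ u, g u = b := by
      intro a b p
      induction p with
      | nil => exact id
      | cons h q ih =>
        rintro ⟨u, rfl⟩
        obtain ⟨w, -, hw⟩ := hlift h
        exact ih ⟨w, hw⟩
    intro z
    obtain ⟨p⟩ := hT.connected s z
    exact this p ⟨r, hgr⟩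
  refine ⟨Equiv.ofBijective g ⟨hinj, hsurj⟩, fun u w => ⟨fun h => ?_, hhom⟩, hEg, hgr⟩
  obtain ⟨w', hw', he⟩ := hlift h
  rwa [← hinj he]

/-! ### Complexity and periodicity -/

theorem Quot.map_id_surjective {V : Type*} {r s : V → V → Prop} (h : ∀ x y, r x y → s x y) :
    Function.Surjective (Quot.map (ra := r) (rb := s) id h) := by
  rintro ⟨x⟩
  exact ⟨Quot.mk _ x, rfl⟩

theorem IsPeriodicColoring.exists_bound {V A : Type*} {T : SimpleGraph V} {φ : V → A}
    (hT : T.Connected) (h : IsPeriodicColoring T φ) :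
    ∃ C : ℕ, ∀ n : ℕ, Finite (Quot (BallEquiv T φ n)) ∧ ballComplexity T φ n ≤ C := by
  obtain ⟨Γ, hadj, hφ, hfin⟩ := h
  refine ⟨Nat.card (Quot fun x y : V => ∃ γ ∈ Γ, γ x = y), fun n => ?_⟩
  have hle (x y : V) : (∃ γ ∈ Γ, γ x = y) → BallEquiv T φ n x y := by
    rintro ⟨γ, hγ, rfl⟩
    exact BallEquiv.of_ball_subset hT (P := fun _ => True) (Q := fun _ => True)
      (γ.subtypeEquiv fun _ => Iff.rfl) (fun u w => (hadj γ hγ u w).symm)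
      (fun v => hφ γ hγ v) ⟨x, trivial⟩ n (fun _ _ => trivial) (fun _ _ => trivial)
  have hs := Quot.map_id_surjective hle
  exact ⟨Finite.of_surjective _ hs, Nat.card_le_card_of_surjective _ hs⟩

theorem exists_ballComplexity_succ_eq {V A : Type*} {T : SimpleGraph V} {φ : V → A}
    (hT : T.Connected)
    (h : ∃ C : ℕ, ∀ n : ℕ, Finite (Quot (BallEquiv T φ n)) ∧ ballComplexity T φ n ≤ C) :
    ∃ n : ℕ, Finite (Quot (BallEquiv T φ n)) ∧
      ballComplexity T φ (n + 1) = ballComplexity T φ n := by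
  obtain ⟨C, hC⟩ := h
  by_contra! hne
  have hlt (n : ℕ) : ballComplexity T φ n < ballComplexity T φ (n + 1) := by
    have := (hC (n + 1)).1
    exact lt_of_le_of_ne (Nat.card_le_card_of_surjective _ (Quot.map_id_surjective
      fun _ _ => BallEquiv.of_succ hT)) (hne n (hC n).1).symm
  have := (strictMono_nat_of_lt_succ hlt).le_apply (x := C + 1)
  have := (hC (C + 1)).2
  omega

theorem BallEquiv.succ_of_ballComplexity_eq {V A : Type*} {T : SimpleGraph V} {φ : V → A}
    (hT : T.Connected) {n : ℕ} (hfin : Finite (Quot (BallEquiv T φ n)))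
    (hcard : ballComplexity T φ (n + 1) = ballComplexity T φ n) {x y : V}
    (h : BallEquiv T φ n x y) : BallEquiv T φ (n + 1) x y := by
  have hne : Nonempty (Quot (BallEquiv T φ n)) := ⟨Quot.mk _ x⟩
  have hpos : 0 < Nat.card (Quot (BallEquiv T φ (n + 1))) := by
    change 0 < ballComplexity T φ (n + 1)
    rw [hcard]
    exact Nat.card_pos
  have : Finite (Quot (BallEquiv T φ (n + 1))) := (Nat.card_pos_iff.1 hpos).2
  have hs := Quot.map_id_surjective (r := BallEquiv T φ (n + 1)) (s := BallEquiv T φ n)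
    fun _ _ => BallEquiv.of_succ hT
  have hinj := (hs.bijective_of_nat_card_le (by exact hcard.le)).1
  have heq := hinj (a₁ := Quot.mk _ x) (a₂ := Quot.mk _ y) (Quot.sound h)
  exact (ballEquiv_equivalence T φ (n + 1)).quot_mk_eq_iff x y |>.1 heq

theorem isPeriodicColoring_of_ballComplexity_succ_eq {V A : Type*} {T : SimpleGraph V}
    {φ : V → A} (hT : T.IsTree)
    (h : ∃ n : ℕ, Finite (Quot (BallEquiv T φ n)) ∧
      ballComplexity T φ (n + 1) = ballComplexity T φ n) :
    IsPeriodicColoring T φ := by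
  obtain ⟨n, hfin, hcard⟩ := h
  let Γ : Subgroup (Equiv.Perm V) :=
    { carrier := {γ | (∀ u w, T.Adj (γ u) (γ w) ↔ T.Adj u w) ∧ ∀ v, φ (γ v) = φ v}
      one_mem' := by simp
      mul_mem' := fun {a b} ha hb =>
        ⟨fun u w => (ha.1 _ _).trans (hb.1 _ _), fun v => (ha.2 _).trans (hb.2 v)⟩
      inv_mem' := fun {a} ha =>
        ⟨fun u w => by simpa using (ha.1 (a⁻¹ u) (a⁻¹ w)).symm,
          fun v => by simpa using (ha.2 (a⁻¹ v)).symm⟩ }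
  refine ⟨Γ, fun γ hγ => hγ.1, fun γ hγ => hγ.2, ?_⟩
  refine Finite.of_surjective _ (Quot.map_id_surjective (r := BallEquiv T φ n) fun x y hxy => ?_)
  obtain ⟨g, hadj, hEg, hg⟩ := hT.exists_automorphism (ballEquiv_equivalence T φ n)
    (fun x y h => (h.succ_of_ballComplexity_eq hT.connected hfin hcard).exists_neighborSet_equiv
      hT.connected) hxy
  exact ⟨g, ⟨hadj, fun v => (hEg v).color_eq.symm⟩, hg⟩

theorem stmt_1 {V A : Type*} (T : SimpleGraph V) (φ : V → A) (k : ℕ)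
    (hk : 2 ≤ k) (htree : T.IsTree) (hreg : ∀ v : V, (T.neighborSet v).ncard = k) :
    (IsPeriodicColoring T φ ↔
      ∃ n : ℕ, Finite (Quot (BallEquiv T φ n)) ∧
        ballComplexity T φ (n + 1) = ballComplexity T φ n) ∧
    (IsPeriodicColoring T φ ↔
      ∃ C : ℕ, ∀ n : ℕ, Finite (Quot (BallEquiv T φ n)) ∧ ballComplexity T φ n ≤ C) := by
  have h12 := fun h => exists_ballComplexity_succ_eq (T := T) (φ := φ) htree.connected h
  have h13 := fun h : IsPeriodicColoring T φ => h.exists_bound htree.connected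
  have h21 := isPeriodicColoring_of_ballComplexity_succ_eq (φ := φ) htree
  exact ⟨⟨fun h => h12 (h13 h), h21⟩, ⟨h13, fun h => h21 (h12 h)⟩⟩
end

section
/- Let x be a vertex of bounded type and let m ≥ −1 be an integer. Then τ(x) ≤ m if and only if every vertex y with [B_{m+1}(x)] = [B_{m+1}(y)] is in the same class as x. -/
open SimpleGraph

/-- Mutually inverse maps between the colored `n`-balls around `x` and `y`, extended arbitrarily
to all vertices. -/
structure IsBallIso {V A : Type*} (T : SimpleGraph V) (φ : V → A) (n : ℕ) (x y : V)
    (f h : V → V) : Prop where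
  map_center : f x = y
  dist_le : ∀ u, T.dist x u ≤ n → T.dist y (f u) ≤ T.dist x u
  dist_symm_le : ∀ w, T.dist y w ≤ n → T.dist x (h w) ≤ T.dist y w
  left_inv : ∀ u, T.dist x u ≤ n → h (f u) = u
  right_inv : ∀ w, T.dist y w ≤ n → f (h w) = w
  adj_iff : ∀ u v, T.dist x u ≤ n → T.dist x v ≤ n → (T.Adj u v ↔ T.Adj (f u) (f v))
  color : ∀ u, T.dist x u ≤ n → φ (f u) = φ u

theorem SimpleGraph.Connected.exists_adj_dist_le {V : Type*} {T : SimpleGraph V}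
    (hT : T.Connected) {x v : V} {r : ℕ} (hv : T.dist x v = r + 1) :
    ∃ u, T.Adj u v ∧ T.dist x u ≤ r := by
  obtain ⟨p, hp⟩ := hT.exists_walk_length_eq_dist v x
  rw [SimpleGraph.dist_comm, hv] at hp
  cases p with
  | nil => simp at hp
  | @cons _ u _ hu q =>
    refine ⟨u, hu.symm, ?_⟩
    rw [SimpleGraph.dist_comm]
    refine (SimpleGraph.dist_le q).trans ?_
    simp only [SimpleGraph.Walk.length_cons] at hp
    omega

theorem SimpleGraph.Connected.dist_map_le {V : Type*} {T : SimpleGraph V}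
    (hT : T.Connected) {x y : V} {n : ℕ} {f : V → V} (hxy : f x = y)
    (hf : ∀ u v, T.dist x u ≤ n → T.dist x v ≤ n → T.Adj u v → T.Adj (f u) (f v))
    (v : V) (hv : T.dist x v ≤ n) : T.dist y (f v) ≤ T.dist x v := by
  induction hr : T.dist x v generalizing v with
  | zero =>
    obtain rfl := hT.dist_eq_zero_iff.mp hr
    simp [hxy]
  | succ r ih =>
    obtain ⟨u, huv, hu⟩ := hT.exists_adj_dist_le hr
    have hxv := hT.dist_triangle (u := x) (v := u) (w := v)
    rw [SimpleGraph.dist_eq_one_iff_adj.mpr huv] at hxv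
    have hu' : T.dist x u = r := by omega
    have hrec := ih u (by omega) hu'
    have htri := hT.dist_triangle (u := y) (v := f u) (w := f v)
    rw [SimpleGraph.dist_eq_one_iff_adj.mpr (hf u v (by omega) hv huv)] at htri
    omega

theorem SimpleGraph.Connected.finite_setOf_dist_le {V : Type*} {T : SimpleGraph V}
    (hT : T.Connected) (hfin : ∀ v, (T.neighborSet v).Finite) (x : V) (n : ℕ) :
    {v | T.dist x v ≤ n}.Finite := by
  induction n with
  | zero =>
    refine (Set.finite_singleton x).subset fun v hv => ?_
    exact (hT.dist_eq_zero_iff.mp (Nat.le_zero.mp hv)).symm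
  | succ n ih =>
    refine (ih.union (ih.biUnion fun u _ => hfin u)).subset fun v hv => ?_
    rcases Nat.lt_or_ge n (T.dist x v) with h | h
    · obtain ⟨u, huv, hu⟩ := hT.exists_adj_dist_le (le_antisymm hv h)
      exact Or.inr (Set.mem_biUnion hu huv)
    · exact Or.inl h

section

variable {V A : Type*} {T : SimpleGraph V} {φ : V → A} {n : ℕ} {x y z : V}

theorem IsBallIso.mono {m : ℕ} {f h : V → V} (hf : IsBallIso T φ n x y f h) (hmn : m ≤ n) :
    IsBallIso T φ m x y f h where
  map_center := hf.map_center
  dist_le u hu := hf.dist_le u (hu.trans hmn)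
  dist_symm_le u hu := hf.dist_symm_le u (hu.trans hmn)
  left_inv u hu := hf.left_inv u (hu.trans hmn)
  right_inv u hu := hf.right_inv u (hu.trans hmn)
  adj_iff u v hu hv := hf.adj_iff u v (hu.trans hmn) (hv.trans hmn)
  color u hu := hf.color u (hu.trans hmn)

theorem IsBallIso.ballEquiv {f h : V → V} (hf : IsBallIso T φ n x y f h) :
    BallEquiv T φ n x y :=
  ⟨{ toFun := fun u => ⟨f u, (hf.dist_le u u.2).trans u.2⟩
     invFun := fun w => ⟨h w, (hf.dist_symm_le w w.2).trans w.2⟩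
     left_inv := fun u => Subtype.ext (hf.left_inv u u.2)
     right_inv := fun w => Subtype.ext (hf.right_inv w w.2) },
    hf.map_center, fun u w => hf.adj_iff u w u.2 w.2, fun v => hf.color v v.2⟩

open Classical in
theorem BallEquiv.exists_isBallIso (hT : T.Connected) (hxy : BallEquiv T φ n x y) :
    ∃ f h, IsBallIso T φ n x y f h := by
  obtain ⟨e, hc, hadj, hcol⟩ := hxy
  let f : V → V := fun v => if hv : T.dist x v ≤ n then e ⟨v, hv⟩ else y
  let h : V → V := fun w => if hw : T.dist y w ≤ n then e.symm ⟨w, hw⟩ else x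
  have hf : ∀ v (hv : T.dist x v ≤ n), f v = e ⟨v, hv⟩ := fun v hv => dif_pos hv
  have hh : ∀ w (hw : T.dist y w ≤ n), h w = e.symm ⟨w, hw⟩ := fun w hw => dif_pos hw
  have hfx : f x = y := (hf x (by simp)).trans hc
  have hfl : ∀ u, T.dist x u ≤ n → h (f u) = u := fun u hu => by
    rw [hf u hu, hh _ (e ⟨u, hu⟩).2]
    simp
  have hfr : ∀ w, T.dist y w ≤ n → f (h w) = w := fun w hw => by
    rw [hh w hw, hf _ (e.symm ⟨w, hw⟩).2]
    simp
  have hfa : ∀ u v, T.dist x u ≤ n → T.dist x v ≤ n → (T.Adj u v ↔ T.Adj (f u) (f v)) :=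
    fun u v hu hv => by
      rw [hf u hu, hf v hv]
      exact hadj ⟨u, hu⟩ ⟨v, hv⟩
  have hhb : ∀ w, T.dist y w ≤ n → T.dist x (h w) ≤ n := fun w hw => by
    rw [hh w hw]
    exact (e.symm ⟨w, hw⟩).2
  refine ⟨f, h, hfx, ?_, ?_, hfl, hfr, hfa, fun u hu => ?_⟩
  · exact hT.dist_map_le hfx fun u v hu hv => (hfa u v hu hv).mp
  · refine hT.dist_map_le (by rw [← hfx, hfl x (by simp)]) fun u v hu hv huv => ?_
    rw [hfa _ _ (hhb u hu) (hhb v hv), hfr u hu, hfr v hv]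
    exact huv
  · rw [hf u hu]
    exact hcol ⟨u, hu⟩

theorem BallEquiv.mono {m : ℕ} (hT : T.Connected) (hxy : BallEquiv T φ n x y) (hmn : m ≤ n) :
    BallEquiv T φ m x y := by
  obtain ⟨f, h, hf⟩ := hxy.exists_isBallIso hT
  exact (hf.mono hmn).ballEquiv

theorem SameClass.symm (hxy : SameClass T φ x y) : SameClass T φ y x := by
  obtain ⟨g, hadj, rfl, hcol⟩ := hxy
  refine ⟨g.symm, fun u w => ?_, g.symm_apply_apply x, fun v => ?_⟩
  · rw [← hadj, g.apply_symm_apply, g.apply_symm_apply]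
  · rw [← hcol, g.apply_symm_apply]

theorem SameClass.trans (hxy : SameClass T φ x y) (hyz : SameClass T φ y z) :
    SameClass T φ x z := by
  obtain ⟨g, hadj, rfl, hcol⟩ := hxy
  obtain ⟨g', hadj', rfl, hcol'⟩ := hyz
  exact ⟨g.trans g', fun u w => (hadj' _ _).trans (hadj _ _), rfl,
    fun v => (hcol' _).trans (hcol v)⟩

theorem SameClass.ballEquiv (hT : T.Connected) (hxy : SameClass T φ x y) (n : ℕ) :
    BallEquiv T φ n x y := by
  obtain ⟨g, hadj, rfl, hcol⟩ := hxy
  refine IsBallIso.ballEquiv (f := g) (h := g.symm) ⟨rfl, ?_, ?_, fun u _ => g.symm_apply_apply u,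
    fun w _ => g.apply_symm_apply w, fun u v _ _ => (hadj u v).symm, fun u _ => hcol u⟩
  · exact hT.dist_map_le rfl fun u v _ _ => (hadj u v).mpr
  · refine hT.dist_map_le (g.symm_apply_apply x) fun u v _ _ huv => ?_
    rwa [← hadj, g.apply_symm_apply, g.apply_symm_apply]

/-- Compactness: in a connected locally finite graph, vertices with equivalent colored balls of
every radius are in the same class. -/
theorem SameClass.of_forall_ballEquiv (hT : T.Connected) (hfin : ∀ v, (T.neighborSet v).Finite)
    (hxy : ∀ n, BallEquiv T φ n x y) : SameClass T φ x y := by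
  choose f h hf using fun n => (hxy n).exists_isBallIso hT
  let U : Ultrafilter ℕ := Filter.hyperfilter ℕ
  have hlarge : ∀ r : ℕ, ∀ᶠ n in (U : Filter ℕ), r ≤ n := fun r =>
    Nat.hyperfilter_le_atTop (Filter.eventually_ge_atTop r)
  have hlim : ∀ (a : ℕ → V) (c : V) (r : ℕ), (∀ n, r ≤ n → T.dist c (a n) ≤ r) →
      ∃ w, ∀ᶠ n in (U : Filter ℕ), a n = w := by
    intro a c r ha
    have hmem : ∀ᶠ n in (U : Filter ℕ), ∃ w ∈ {v | T.dist c v ≤ r}, a n = w :=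
      (hlarge r).mono fun n hn => ⟨a n, ha n hn, rfl⟩
    obtain ⟨w, -, hw⟩ :=
      (Ultrafilter.eventually_exists_mem_iff (hT.finite_setOf_dist_le hfin c r)).mp hmem
    exact ⟨w, hw⟩
  choose g hg using fun v => hlim (fun n => f n v) y (T.dist x v) fun n hn => (hf n).dist_le v hn
  choose g' hg' using fun w => hlim (fun n => h n w) x (T.dist y w)
    fun n hn => (hf n).dist_symm_le w hn
  refine ⟨⟨g, g', fun v => ?_, fun w => ?_⟩, fun u w => ?_, ?_, fun v => ?_⟩
  · obtain ⟨n, h1, h2, h3⟩ := ((hg v).and ((hg' (g v)).and (hlarge (T.dist x v)))).exists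
    rw [← h2, ← h1, (hf n).left_inv v h3]
  · obtain ⟨n, h1, h2, h3⟩ := ((hg' w).and ((hg (g' w)).and (hlarge (T.dist y w)))).exists
    rw [← h2, ← h1, (hf n).right_inv w h3]
  · obtain ⟨n, h1, h2, h3, h4⟩ := ((hg u).and ((hg w).and
      ((hlarge (T.dist x u)).and (hlarge (T.dist x w))))).exists
    rw [Equiv.coe_fn_mk, ← h1, ← h2]
    exact ((hf n).adj_iff u w h3 h4).symm
  · obtain ⟨n, hn⟩ := (hg x).exists
    exact hn.symm.trans (hf n).map_center
  · obtain ⟨n, h1, h2⟩ := ((hg v).and (hlarge (T.dist x v))).exists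
    rw [Equiv.coe_fn_mk, ← h1]
    exact (hf n).color v h2

theorem maxType_le_iff (hx : (TypeSet T φ x).Finite) {m : ℤ} (hm : -1 ≤ m) :
    maxType T φ x ≤ m ↔ ∀ n ∈ TypeSet T φ x, (n : ℤ) ≤ m := by
  rw [maxType, csSup_le_iff ((hx.image _).insert _).bddAbove (Set.insert_nonempty _ _)]
  simp [hm]

end

theorem stmt_5 {V A : Type*} (T : SimpleGraph V) (φ : V → A) (k : ℕ)
    (hk : 2 ≤ k) (htree : T.IsTree) (hreg : ∀ v : V, (T.neighborSet v).ncard = k)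
    (x : V) (hx : (TypeSet T φ x).Finite) (m : ℤ) (hm : -1 ≤ m) :
    maxType T φ x ≤ m ↔
      ∀ y : V, BallEquiv T φ ((m + 1).toNat) x y → SameClass T φ x y := by
  have hT := htree.connected
  have hfin : ∀ v, (T.neighborSet v).Finite := fun v =>
    Set.finite_of_ncard_pos (by rw [hreg v]; omega)
  rw [maxType_le_iff hx hm]
  constructor
  · intro hspecial y hy
    have hge : ∀ n, (m + 1).toNat ≤ n → BallEquiv T φ n x y := by
      intro n hn
      induction n, hn using Nat.le_induction with
      | base => exact hy
      | succ n hn ih =>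
        by_contra hne
        have := hspecial n ⟨x, y, SameClass.ballEquiv hT
          ⟨Equiv.refl V, fun _ _ => Iff.rfl, rfl, fun _ => rfl⟩ n, ih, hne⟩
        omega
    exact .of_forall_ballEquiv hT hfin fun n =>
      (hge (max n (m + 1).toNat) (le_max_right _ _)).mono hT (le_max_left _ _)
  · rintro hclass n ⟨y, z, hy, hz, hyz⟩
    by_contra! hn
    have hle : (m + 1).toNat ≤ n := by omega
    exact hyz (((hclass y (hy.mono hT hle)).symm.trans
      (hclass z (hz.mono hT hle))).ballEquiv hT (n + 1))
end
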